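/- arXiv:1611.04054 — 4 statements merged into one kernel-verified Lean document; each statement's English description precedes it below -/
import Mathlib

section
/- Let H be a real inner product space and let r, r' ∈ H be nonzero vectors. Let 0 < q < 1, let q̄ satisfy q < q̄ ≤ 1, let ε_T > 0, and let γ ≥ 1 satisfy γ·ε_T < 1. Assume the rate-tolerance condition |‖r'‖/‖r‖ − (1 − 1/γ)| < ε_T holds, and define the updated parameter γ⁺ := max{1, q·‖r‖²/(‖r‖² − ⟨r, r'⟩)}. If the direction cosine satisfies ⟨r, r'⟩/(‖r‖·‖r'‖) < (γ − q/q̄)/(γ·(1 + ε_T) − 1), then γ⁺ < q̄·γ or γ⁺ = 1. -/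
open RealInnerProductSpace

/-- Lemma 4.2 (Preasymptotic decrease of γ₁₀): under the rate-tolerance condition,
if the direction cosine of consecutive residuals satisfies the stated bound, then
the updated numerical dissipation parameter decreases by factor q̄, or equals 1. -/
theorem preasymptotic_decrease_gamma
    {H : Type*} [NormedAddCommGroup H] [InnerProductSpace ℝ H]
    (r r' : H) (hr : r ≠ 0) (hr' : r' ≠ 0)
    (q qbar εT γ : ℝ)
    (hq0 : 0 < q) (hq1 : q < 1) (hqbar1 : q < qbar) (hqbar2 : qbar ≤ 1)
    (hεT : 0 < εT) (hγ : 1 ≤ γ) (hγεT : γ * εT < 1)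
    (hrate : |‖r'‖ / ‖r‖ - (1 - 1/γ)| < εT)
    (hcos : ⟪r, r'⟫ / (‖r‖ * ‖r'‖) < (γ - q/qbar) / (γ * (1 + εT) - 1)) :
    max 1 (q * ‖r‖^2 / (‖r‖^2 - ⟪r, r'⟫)) < qbar * γ ∨
      max 1 (q * ‖r‖^2 / (‖r‖^2 - ⟪r, r'⟫)) = 1 := by
  have ha : 0 < ‖r‖ := norm_pos_iff.mpr hr
  have hb : 0 < ‖r'‖ := norm_pos_iff.mpr hr'
  have hγ0 : 0 < γ := by linarith
  have hqbar0 : 0 < qbar := hq0.trans hqbar1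
  rcases le_or_gt (q * ‖r‖ ^ 2 / (‖r‖ ^ 2 - ⟪r, r'⟫)) 1 with hle | hgt
  · exact Or.inr (max_eq_left hle)
  left
  rw [max_eq_right hgt.le]
  have ha2 : 0 < ‖r‖ ^ 2 := by positivity
  have hinner : 0 < ⟪r, r'⟫ := by
    by_contra! hneg
    refine absurd hgt (not_lt.mpr ?_)
    rw [div_le_one (by linarith)]
    nlinarith
  have hD : 0 < γ * (1 + εT) - 1 := by nlinarith [mul_pos hγ0 hεT]
  rw [div_lt_div_iff₀ (mul_pos ha hb) hD] at hcos
  have hN : 0 < γ - q / qbar :=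
    pos_of_mul_pos_left ((mul_pos hinner hD).trans hcos) (mul_pos ha hb).le
  have hnorm : ‖r'‖ * γ < (γ * (1 + εT) - 1) * ‖r‖ := by
    have hratio : ‖r'‖ / ‖r‖ < 1 - 1 / γ + εT := by linarith [(abs_lt.mp hrate).2]
    rw [div_lt_iff₀ ha] at hratio
    calc ‖r'‖ * γ < (1 - 1 / γ + εT) * ‖r‖ * γ := by gcongr
      _ = (γ * (1 + εT) - 1) * ‖r‖ := by field_simp; ring
  have hbound : γ * ⟪r, r'⟫ < (γ - q / qbar) * ‖r‖ ^ 2 := by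
    refine lt_of_mul_lt_mul_right ?_ hD.le
    calc γ * ⟪r, r'⟫ * (γ * (1 + εT) - 1)
        = γ * (⟪r, r'⟫ * (γ * (1 + εT) - 1)) := by ring
      _ < γ * ((γ - q / qbar) * (‖r‖ * ‖r'‖)) := by gcongr
      _ = (γ - q / qbar) * ‖r‖ * (‖r'‖ * γ) := by ring
      _ < (γ - q / qbar) * ‖r‖ * ((γ * (1 + εT) - 1) * ‖r‖) := by gcongr
      _ = (γ - q / qbar) * ‖r‖ ^ 2 * (γ * (1 + εT) - 1) := by ring
  have hgap : q / qbar * ‖r‖ ^ 2 < γ * (‖r‖ ^ 2 - ⟪r, r'⟫) := by linarith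
  have hden : 0 < ‖r‖ ^ 2 - ⟪r, r'⟫ :=
    pos_of_mul_pos_right ((by positivity : 0 < q / qbar * ‖r‖ ^ 2).trans hgap) hγ0.le
  rw [div_lt_iff₀ hden]
  calc q * ‖r‖ ^ 2 = qbar * (q / qbar * ‖r‖ ^ 2) := by field_simp
    _ < qbar * (γ * (‖r‖ ^ 2 - ⟪r, r'⟫)) := by gcongr
    _ = qbar * γ * (‖r‖ ^ 2 - ⟪r, r'⟫) := by ring
end

section
/- Let H be a real inner product space and let r, r' ∈ H with r ≠ 0. Let 0 < q < 1, let q̄ satisfy q < q̄ ≤ 1, and let γ ≥ 1. Define ε̆ := ‖r'‖/‖r‖ − (1 − 1/γ) and the updated parameter γ⁺ := max{1, q·‖r‖²/(‖r‖² − ⟨r, r'⟩)}. If ε̆ < (1/γ)·(1 − q/q̄), then γ⁺ < q̄·γ or γ⁺ = 1. -/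
open RealInnerProductSpace

/-- Corollary 4.3: a reliable predictor for the decrease of the numerical dissipation
parameter. If the observed deviation ε̆ from the predicted rate satisfies
ε̆ < (1/γ)(1 - q/q̄), then the update decreases by factor q̄ or equals 1. -/
theorem gamma_update_decrease_predictor
    {H : Type*} [NormedAddCommGroup H] [InnerProductSpace ℝ H]
    (r r' : H) (hr : r ≠ 0)
    (q qbar γ : ℝ)
    (hq0 : 0 < q) (hq1 : q < 1) (hqbar1 : q < qbar) (hqbar2 : qbar ≤ 1)
    (hγ : 1 ≤ γ)
    (hbreve : ‖r'‖ / ‖r‖ - (1 - 1/γ) < (1/γ) * (1 - q/qbar)) :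
    max 1 (q * ‖r‖^2 / (‖r‖^2 - ⟪r, r'⟫)) < qbar * γ ∨
      max 1 (q * ‖r‖^2 / (‖r‖^2 - ⟪r, r'⟫)) = 1 := by
  have hn : 0 < ‖r‖ := norm_pos_iff.mpr hr
  have hqb : 0 < qbar := hq0.trans hqbar1
  have hγ0 : 0 < γ := one_pos.trans_le hγ
  have hratio : q / (qbar * γ) < 1 - ‖r'‖ / ‖r‖ := by
    have h : (1 / γ) * (1 - q / qbar) = 1 / γ - q / (qbar * γ) := by
      field_simp
    linarith
  have hden : q / (qbar * γ) * ‖r‖ ^ 2 < ‖r‖ ^ 2 - ⟪r, r'⟫ := by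
    have hscaled := mul_lt_mul_of_pos_right hratio (pow_pos hn 2)
    have h : (1 - ‖r'‖ / ‖r‖) * ‖r‖ ^ 2 = ‖r‖ ^ 2 - ‖r‖ * ‖r'‖ := by
      field_simp
    linarith [real_inner_le_norm r r']
  have hpos : 0 < ‖r‖ ^ 2 - ⟪r, r'⟫ := lt_trans (by positivity) hden
  rcases le_total (q * ‖r‖ ^ 2 / (‖r‖ ^ 2 - ⟪r, r'⟫)) 1 with hle | hge
  · exact Or.inr (max_eq_left hle)
  · left
    rw [max_eq_right hge, div_lt_iff₀ hpos]
    calc q * ‖r‖ ^ 2 = qbar * γ * (q / (qbar * γ) * ‖r‖ ^ 2) := by field_simp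
      _ < qbar * γ * (‖r‖ ^ 2 - ⟪r, r'⟫) :=
        mul_lt_mul_of_pos_left hden (mul_pos hqb hγ0)
end

section
/- Let H be a real inner product space and let r, r' ∈ H be nonzero vectors. Let q > 0, ε_T > 0, and γ ≥ 1 with γ·ε_T < 1. Suppose the rate-tolerance condition |‖r'‖/‖r‖ − (1 − 1/γ)| < ε_T holds and that the direction cosine cos(r, r') := ⟨r, r'⟩/(‖r‖·‖r'‖) is strictly positive. Then 1 − cos(r, r')·(1 − 1/γ + ε_T) > 0, the quantity ‖r‖² − ⟨r, r'⟩ is strictly positive, and q·‖r‖²/(‖r‖² − ⟨r, r'⟩) < q/(1 − cos(r, r')·(1 − 1/γ + ε_T)). -/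
open RealInnerProductSpace

/-- The key inequality (4.12) in the proof of Lemma 4.2. -/
theorem gamma_update_key_inequality
    {H : Type*} [NormedAddCommGroup H] [InnerProductSpace ℝ H]
    (r r' : H) (hr : r ≠ 0) (hr' : r' ≠ 0)
    (q εT γ : ℝ)
    (hq : 0 < q) (hεT : 0 < εT) (hγ : 1 ≤ γ) (hγεT : γ * εT < 1)
    (hrate : |‖r'‖ / ‖r‖ - (1 - 1/γ)| < εT)
    (hcos : 0 < ⟪r, r'⟫ / (‖r‖ * ‖r'‖)) :
    0 < 1 - (⟪r, r'⟫ / (‖r‖ * ‖r'‖)) * (1 - 1/γ + εT) ∧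
    0 < ‖r‖^2 - ⟪r, r'⟫ ∧
    q * ‖r‖^2 / (‖r‖^2 - ⟪r, r'⟫) <
      q / (1 - (⟪r, r'⟫ / (‖r‖ * ‖r'‖)) * (1 - 1/γ + εT)) := by
  have hn : 0 < ‖r‖ := norm_pos_iff.mpr hr
  have hn' : 0 < ‖r'‖ := norm_pos_iff.mpr hr'
  have hc_le : ⟪r, r'⟫ / (‖r‖ * ‖r'‖) ≤ 1 :=
    div_le_one_of_le₀ (real_inner_le_norm r r') (by positivity)
  have hinner : ⟪r, r'⟫ = ‖r‖ ^ 2 * (⟪r, r'⟫ / (‖r‖ * ‖r'‖) * (‖r'‖ / ‖r‖)) := by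
    field_simp
  have hεT_lt : εT < 1 / γ := by
    rw [lt_div_iff₀ (by linarith)]
    linarith
  have hrate_lt : ‖r'‖ / ‖r‖ < 1 - 1 / γ + εT := by
    linarith [(abs_lt.mp hrate).2]
  have hrate_pos : 0 < ‖r'‖ / ‖r‖ := div_pos hn' hn
  generalize ⟪r, r'⟫ / (‖r‖ * ‖r'‖) = c at *
  generalize ‖r'‖ / ‖r‖ = t at *
  have hs_lt : 1 - 1 / γ + εT < 1 := by linarith
  generalize 1 - 1 / γ + εT = s at *
  have hpos : 0 < 1 - c * s := by nlinarith
  have hlt : 1 - c * s < 1 - c * t := by nlinarith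
  have hfactor : ‖r‖ ^ 2 - ⟪r, r'⟫ = (1 - c * t) * ‖r‖ ^ 2 := by
    linear_combination -hinner
  refine ⟨hpos, ?_, ?_⟩
  · rw [hfactor]
    exact mul_pos (hpos.trans hlt) (by positivity)
  · rw [hfactor, mul_div_mul_right _ _ (by positivity)]
    exact div_lt_div_of_pos_left hq hpos hlt
end

section
/- Let H be a real inner product space and let r, r' ∈ H be nonzero vectors. Let 0 < q < 1, let q̄ satisfy q < q̄ ≤ 1, let ε_T > 0, and let γ satisfy 1 ≤ γ, γ·ε_T < 1, and γ < (1/ε_T)·(1 − q/q̄). Assume the rate-tolerance condition |‖r'‖/‖r‖ − (1 − 1/γ)| < ε_T holds, and define γ⁺ := max{1, q·‖r‖²/(‖r‖² − ⟨r, r'⟩)}. Then γ⁺ < q̄·γ or γ⁺ = 1. -/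
open RealInnerProductSpace

/-- Monotone-decrease regime: for γ strictly below γ_MONO(q̄) = (1/ε_T)(1 - q/q̄),
the update of the numerical dissipation parameter decreases by factor q̄ or equals 1,
for any pair of consecutive nonzero residuals satisfying the rate-tolerance condition. -/
theorem gamma_monotone_decrease_regime
    {H : Type*} [NormedAddCommGroup H] [InnerProductSpace ℝ H]
    (r r' : H) (hr : r ≠ 0) (hr' : r' ≠ 0)
    (q qbar εT γ : ℝ)
    (hq0 : 0 < q) (hq1 : q < 1) (hqbar1 : q < qbar) (hqbar2 : qbar ≤ 1)
    (hεT : 0 < εT) (hγ1 : 1 ≤ γ) (hγεT : γ * εT < 1)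
    (hγmono : γ < (1/εT) * (1 - q/qbar))
    (hrate : |‖r'‖ / ‖r‖ - (1 - 1/γ)| < εT) :
    max 1 (q * ‖r‖^2 / (‖r‖^2 - ⟪r, r'⟫)) < qbar * γ ∨
      max 1 (q * ‖r‖^2 / (‖r‖^2 - ⟪r, r'⟫)) = 1 := by
  have hR : 0 < ‖r‖ := norm_pos_iff.mpr hr
  have hγ : 0 < γ := by linarith
  have hqbar : 0 < qbar := by linarith
  have hεγ : εT < (1 - q / qbar) / γ := by
    rw [lt_div_iff₀ hγ]
    rwa [one_div_mul_eq_div, lt_div_iff₀ hεT, mul_comm] at hγmono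
  have hratio : ‖r'‖ / ‖r‖ < 1 - q / qbar / γ := by
    have h := (abs_lt.mp hrate).2
    rw [sub_div] at hεγ
    linarith
  rw [div_lt_iff₀ hR] at hratio
  have hgap : q / qbar / γ * ‖r‖ ^ 2 < ‖r‖ ^ 2 - ⟪r, r'⟫ := by
    have h := mul_lt_mul_of_pos_left hratio hR
    linarith [real_inner_le_norm r r']
  have hden : 0 < ‖r‖ ^ 2 - ⟪r, r'⟫ := lt_trans (by positivity) hgap
  have hquot : q * ‖r‖ ^ 2 / (‖r‖ ^ 2 - ⟪r, r'⟫) < qbar * γ := by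
    rw [div_lt_iff₀ hden]
    calc q * ‖r‖ ^ 2 = qbar * γ * (q / qbar / γ * ‖r‖ ^ 2) := by field_simp
      _ < qbar * γ * (‖r‖ ^ 2 - ⟪r, r'⟫) := by gcongr
  rcases le_total (q * ‖r‖ ^ 2 / (‖r‖ ^ 2 - ⟪r, r'⟫)) 1 with h | h
  · exact Or.inr (max_eq_left h)
  · exact Or.inl (by rwa [max_eq_right h])
end
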